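/- arXiv:math/0610778 — 2 statements merged into one kernel-verified Lean document; each statement's English description precedes it below -/
import Mathlib

section
/- Let C be a category in which every morphism is both a monomorphism and an epimorphism (a cancellative category), let φ : C ⥤ C be a functor, and Δ : 𝟭_C ⟶ φ a natural transformation. Fix m ≥ 1 and consider an m-term factorization of Δ: objects x₁, …, x_{m+1} with x_{m+1} = φ(x₁) and morphisms f_i : x_i ⟶ x_{i+1} (1 ≤ i ≤ m) with f₁ ≫ ⋯ ≫ f_m = Δ_{x₁}. Define the rotation operator σ sending such a factorization (f₁, …, f_m) of Δ_{x₁} to (f₂, …, f_m, φ(f₁)), which is again an m-term factorization of Δ (now of Δ_{x₂}). Then applying σ exactly m times to (f₁, …, f_m) yields (φ(f₁), …, φ(f₂), …, φ(f_m)), the image of the original factorization under φ. In particular σ is well defined on m-term factorizations of Δ and its m-th iterate acts as φ. -/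
/-!
STATEMENT 8: In a cancellative category, the rotation operator `σ` sending an `m`-term
factorization `(f₁, …, f_m)` of `Δ` to `(f₂, …, f_m, φ(f₁))` is well defined on `m`-term
factorizations of `Δ`, and its `m`-th iterate acts as `φ`.
-/

open CategoryTheory

/-- The composite `f₁ ≫ f₂ ≫ ⋯ ≫ f_m` of a chain of composable morphisms. -/
def chainComp {C : Type*} [Category C] : ∀ {m : ℕ} (obj : Fin (m + 1) → C)
    (hom : ∀ i : Fin m, obj i.castSucc ⟶ obj i.succ), obj 0 ⟶ obj (Fin.last m)
  | 0, obj, _ => 𝟙 (obj 0)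
  | _ + 1, obj, hom => hom 0 ≫ chainComp (fun i => obj i.succ) (fun i => hom i.succ)

/-- An `m`-term factorization of `Δ`: objects `x₁, …, x_{m+1}` with `x_{m+1} = φ(x₁)` and
morphisms `f_i : x_i ⟶ x_{i+1}` whose composite is `Δ_{x₁}`. -/
structure DeltaFactorization {C : Type*} [Category C] (φ : C ⥤ C) (Δ : 𝟭 C ⟶ φ)
    (m : ℕ) where
  obj : Fin (m + 1) → C
  hom : ∀ i : Fin m, obj i.castSucc ⟶ obj i.succ
  last_eq : obj (Fin.last m) = φ.obj (obj 0)
  comp_eq : chainComp obj hom = Δ.app (obj 0) ≫ eqToHom last_eq.symm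

namespace CategoryTheory

theorem Arrow.mk_eq_mk_of_heq {C : Type*} [Category C] {x y x' y' : C} {f : x ⟶ y}
    {g : x' ⟶ y'} (hx : x = x') (hy : y = y') (h : HEq f g) : Arrow.mk f = Arrow.mk g := by
  subst hx hy
  rw [eq_of_heq h]

theorem Arrow.heq_of_mk_eq_mk {C : Type*} [Category C] {x y x' y' : C} {f : x ⟶ y}
    {g : x' ⟶ y'} (h : Arrow.mk f = Arrow.mk g) : HEq f g := by
  cases h
  rfl

end CategoryTheory

theorem chainComp_succ_last {C : Type*} [Category C] {m : ℕ} (obj : Fin (m + 2) → C)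
    (hom : ∀ i : Fin (m + 1), obj i.castSucc ⟶ obj i.succ) :
    chainComp obj hom =
      chainComp (fun i : Fin (m + 1) => obj i.castSucc) (fun i => hom i.castSucc) ≫
        hom (Fin.last m) := by
  induction m with
  | zero => exact (Category.comp_id _).trans (Category.id_comp _).symm
  | succ m ih =>
    exact (congrArg (hom 0 ≫ ·) (ih (fun i => obj i.succ) fun i => hom i.succ)).trans
      (Category.assoc _ _ _).symm

/-- A chain of composable morphisms can be extended by one morphism at its end. -/
theorem exists_chain_snoc {C : Type*} [Category C] {m : ℕ} (obj : Fin (m + 1) → C)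
    (hom : ∀ i : Fin m, obj i.castSucc ⟶ obj i.succ) {y : C} (g : obj (Fin.last m) ⟶ y) :
    ∃ (obj' : Fin (m + 2) → C) (hom' : ∀ i : Fin (m + 1), obj' i.castSucc ⟶ obj' i.succ)
      (h₀ : obj' 0 = obj 0) (hl : obj' (Fin.last (m + 1)) = y),
      (∀ i : Fin (m + 1), obj' i.castSucc = obj i) ∧
      (∀ i : Fin m, HEq (hom' i.castSucc) (hom i)) ∧ HEq (hom' (Fin.last m)) g ∧
      chainComp obj' hom' = eqToHom h₀ ≫ (chainComp obj hom ≫ g) ≫ eqToHom hl.symm := by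
  obtain ⟨obj', hc, hl⟩ : ∃ obj' : Fin (m + 2) → C,
      obj = (fun i : Fin (m + 1) => obj' i.castSucc) ∧ y = obj' (Fin.last (m + 1)) :=
    ⟨Fin.snoc (α := fun _ => C) obj y, by ext; simp, by simp⟩
  subst hc hl
  let hom' : ∀ i : Fin (m + 1), obj' i.castSucc ⟶ obj' i.succ := fun i =>
    Fin.lastCases (motive := fun i : Fin (m + 1) => obj' i.castSucc ⟶ obj' i.succ) g hom i
  have hc (i : Fin m) : hom' i.castSucc = hom i := Fin.lastCases_castSucc i
  have hl : hom' (Fin.last m) = g := Fin.lastCases_last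
  refine ⟨obj', hom', rfl, rfl, fun _ => rfl, fun i => heq_of_eq (hc i), heq_of_eq hl, ?_⟩
  rw [chainComp_succ_last, hl, funext hc]
  exact ((Category.id_comp _).trans (Category.comp_id _)).symm

theorem CategoryTheory.NatTrans.eqToHom_app_eqToHom {C D : Type*} [Category C] [Category D]
    {F G : C ⥤ D} (α : F ⟶ G) {x y : C} {z : D} (h : x = y) (h' : G.obj y = z) :
    eqToHom (congrArg F.obj h) ≫ α.app y ≫ eqToHom h' =
      α.app x ≫ eqToHom ((congrArg G.obj h).trans h') := by
  subst h h'
  simp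

namespace DeltaFactorization

variable {C : Type*} [Category C] {φ : C ⥤ C} {Δ : 𝟭 C ⟶ φ}

theorem tail_comp_map {n : ℕ} (f : DeltaFactorization φ Δ (n + 1)) [Epi (f.hom 0)] :
    chainComp (fun i => f.obj i.succ) (fun i => f.hom i.succ) ≫ eqToHom f.last_eq ≫
      φ.map (f.hom 0) = Δ.app (f.obj 1) := by
  refine (cancel_epi (f.hom 0)).1 ?_
  have h : f.hom 0 ≫ chainComp (fun i => f.obj i.succ) (fun i => f.hom i.succ) =
      Δ.app (f.obj 0) ≫ eqToHom f.last_eq.symm := f.comp_eq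
  have hΔ : f.hom 0 ≫ Δ.app (f.obj 1) = Δ.app (f.obj 0) ≫ φ.map (f.hom 0) :=
    Δ.naturality (f.hom 0)
  refine (Category.assoc _ _ _).symm.trans ((congrArg (· ≫ _) h).trans (Eq.trans ?_ hΔ.symm))
  exact (Category.assoc _ _ _).trans
    (congrArg (Δ.app (f.obj 0) ≫ ·) ((eqToHom_trans_assoc _ _ _).trans (Category.id_comp _)))

theorem exists_rotation {n : ℕ} (f : DeltaFactorization φ Δ (n + 1)) [Epi (f.hom 0)] :
    ∃ g : DeltaFactorization φ Δ (n + 1),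
      (∀ i : Fin (n + 1), g.obj i.castSucc = f.obj i.succ) ∧
      g.obj (Fin.last (n + 1)) = φ.obj (f.obj 1) ∧
      (∀ i : Fin n, HEq (g.hom i.castSucc) (f.hom i.succ)) ∧
      HEq (g.hom (Fin.last n)) (φ.map (f.hom 0)) := by
  obtain ⟨obj, hom, h₀, hl, hobj, hhom, hlast, hcomp⟩ :=
    exists_chain_snoc (fun i => f.obj i.succ) (fun i => f.hom i.succ)
      (eqToHom f.last_eq ≫ φ.map (f.hom 0))
  have h : obj (Fin.last (n + 1)) = φ.obj (obj 0) := hl.trans (congrArg φ.obj h₀.symm)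
  refine ⟨⟨obj, hom, h, ?_⟩, hobj, hl, hhom, hlast.trans (eqToHom_comp_heq _ _)⟩
  rw [hcomp]
  refine (congrArg (fun k => eqToHom h₀ ≫ k ≫ eqToHom hl.symm) f.tail_comp_map).trans ?_
  exact NatTrans.eqToHom_app_eqToHom Δ h₀ hl.symm

/-- The `i`-th morphism of a factorization, as an object of the arrow category. -/
def arrow {m : ℕ} (f : DeltaFactorization φ Δ m) (i : Fin m) : Arrow C :=
  Arrow.mk (f.hom i)

/-- If `σ` rotates factorizations, then `σ^[k]` moves the first `k` morphisms to the end while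
applying `φ` to them. -/
theorem arrow_iterate {m : ℕ} {σ : DeltaFactorization φ Δ m → DeltaFactorization φ Δ m}
    (hσ : ∀ f (i : ℕ) (hi : i + 1 < m), (σ f).arrow ⟨i, by omega⟩ = f.arrow ⟨i + 1, hi⟩)
    (hσ' : ∀ f (i : ℕ) (hi : i + 1 = m),
      (σ f).arrow ⟨i, by omega⟩ = φ.mapArrow.obj (f.arrow ⟨0, by omega⟩))
    (f : DeltaFactorization φ Δ m) (k : ℕ) (hk : k ≤ m) (i : ℕ) (hi : i < m) :
    (σ^[k] f).arrow ⟨i, hi⟩ =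
      if h : i + k < m then f.arrow ⟨i + k, h⟩
      else φ.mapArrow.obj (f.arrow ⟨i + k - m, by omega⟩) := by
  induction k generalizing i with
  | zero => simp [hi]
  | succ k ih =>
    rw [Function.iterate_succ_apply']
    by_cases h : i + 1 < m
    · rw [hσ _ _ h, ih (by omega) _ h]
      simp only [Nat.add_assoc, Nat.add_comm 1 k]
    · have hm : i + 1 = m := by omega
      rw [hσ' _ _ hm, ih (by omega), dif_pos (by omega), dif_neg (by omega)]
      congr 3
      omega

end DeltaFactorization

/-- In a cancellative category, the rotation `(f₁, …, f_m) ↦ (f₂, …, f_m, φ(f₁))` is a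
well-defined operator `σ` on `m`-term factorizations of `Δ`, and applying `σ` exactly `m`
times yields the image of the original factorization under `φ`. -/
theorem rotation_welldefined_and_iterate_eq_map {C : Type*} [Category C]
    (hmono : ∀ {x y : C} (f : x ⟶ y), Mono f) (hepi : ∀ {x y : C} (f : x ⟶ y), Epi f)
    (φ : C ⥤ C) (Δ : 𝟭 C ⟶ φ) (m : ℕ) (hm : 1 ≤ m) :
    ∃ σ : DeltaFactorization φ Δ m → DeltaFactorization φ Δ m,
      (∀ f : DeltaFactorization φ Δ m,
        -- `σ` acts by rotation on the objects …
        (∀ i : Fin (m + 1), (hi : i.val < m) → (σ f).obj i = f.obj ⟨i.val + 1, by omega⟩) ∧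
        (σ f).obj (Fin.last m) = φ.obj (f.obj ⟨1, by omega⟩) ∧
        -- … and on the morphisms: `σ (f₁, …, f_m) = (f₂, …, f_m, φ(f₁))`.
        (∀ i : Fin m, (hi : i.val + 1 < m) → HEq ((σ f).hom i) (f.hom ⟨i.val + 1, hi⟩)) ∧
        HEq ((σ f).hom ⟨m - 1, by omega⟩) (φ.map (f.hom ⟨0, by omega⟩))) ∧
      -- the `m`-th iterate of `σ` is the image under `φ`
      (∀ f : DeltaFactorization φ Δ m,
        (σ^[m] f).obj = (fun i => φ.obj (f.obj i)) ∧
        ∀ i : Fin m, HEq ((σ^[m] f).hom i) (φ.map (f.hom i))) := by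
  obtain ⟨n, rfl⟩ : ∃ n, m = n + 1 := ⟨m - 1, by omega⟩
  have hex (f : DeltaFactorization φ Δ (n + 1)) :=
    have := hepi (f.hom 0)
    f.exists_rotation
  choose σ hobj hlast hhom hmap using hex
  refine ⟨σ, fun f => ⟨fun i hi => hobj f ⟨i, hi⟩, hlast f,
    fun i hi => hhom f ⟨i, by omega⟩, hmap f⟩, fun f => ?_⟩
  have key (i : Fin (n + 1)) :
      (σ^[n + 1] f).arrow i = φ.mapArrow.obj (f.arrow i) := by
    refine (DeltaFactorization.arrow_iterate (σ := σ) (fun f i hi => ?_) (fun f i hi => ?_)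
      f (n + 1) le_rfl i i.isLt).trans ?_
    · exact Arrow.mk_eq_mk_of_heq (hobj f ⟨i, by omega⟩) (hobj f ⟨i + 1, by omega⟩)
        (hhom f ⟨i, by omega⟩)
    · obtain rfl : n = i := by omega
      exact Arrow.mk_eq_mk_of_heq ((hobj f (Fin.last n)).trans f.last_eq) (hlast f) (hmap f)
    · rw [dif_neg (by omega)]
      simp only [Nat.add_sub_cancel]
  have hleft (i : Fin (n + 1)) :
      (σ^[n + 1] f).obj i.castSucc = φ.obj (f.obj i.castSucc) :=
    congrArg Comma.left (key i)
  refine ⟨funext fun i => ?_, fun i => Arrow.heq_of_mk_eq_mk (key i)⟩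
  induction i using Fin.lastCases with
  | last => rw [DeltaFactorization.last_eq, f.last_eq]; exact congrArg φ.obj (hleft 0)
  | cast i => exact hleft i
end

section
/- Let G be a groupoid, φ : G ⥤ G a functor, Δ : 𝟭_G ⟶ φ a natural transformation, p ≥ 1 an integer, and x an object of G such that φ^p(x) = x, where φ^p denotes the p-fold composite of φ with itself; call h this equality. Let Δ^p_x : x ⟶ x denote the loop obtained by composing Δ_x ≫ Δ_{φ(x)} ≫ ⋯ ≫ Δ_{φ^{p-1}(x)} : x ⟶ φ^p(x) with the canonical identification eqToHom h : φ^p(x) ⟶ x. Then for every c : x ⟶ x, one has c ≫ Δ^p_x = Δ^p_x ≫ c if and only if φ^p(c) = eqToHom(h) ≫ c ≫ eqToHom(h.symm); that is, the centralizer of Δ^p_x in the automorphism group of x consists exactly of the morphisms of x fixed by φ^p (after transport along h). -/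
/-!
STATEMENT 9: In a groupoid `G` with `φ : G ⥤ G`, `Δ : 𝟭 G ⟶ φ`, `p ≥ 1` and `φ^p(x) = x`,
the centralizer of the loop `Δ^p_x := Δ_x ≫ Δ_{φx} ≫ ⋯ ≫ Δ_{φ^{p-1}x} ≫ eqToHom h` in the
vertex group at `x` consists exactly of the morphisms fixed by `φ^p` (after transport).
-/

open CategoryTheory

/-- The `p`-fold composite `φ ⋙ ⋯ ⋙ φ` of an endofunctor. -/
def funcPow {C : Type*} [Category C] (φ : C ⥤ C) : ℕ → C ⥤ C
  | 0 => Functor.id C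
  | n + 1 => funcPow φ n ⋙ φ

/-- The composite `Δ_x ≫ Δ_{φ(x)} ≫ ⋯ ≫ Δ_{φ^{p-1}(x)} : x ⟶ φ^p(x)`. -/
def deltaIter {C : Type*} [Category C] (φ : C ⥤ C) (Δ : 𝟭 C ⟶ φ) :
    ∀ (p : ℕ) (x : C), x ⟶ (funcPow φ p).obj x
  | 0, x => 𝟙 x
  | n + 1, x => deltaIter φ Δ n x ≫ Δ.app ((funcPow φ n).obj x)

/-- The iterates of `Δ` are natural with respect to `φ^p`. -/
theorem deltaIter_naturality {C : Type*} [Category C] (φ : C ⥤ C) (Δ : 𝟭 C ⟶ φ)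
    (p : ℕ) {x y : C} (f : x ⟶ y) :
    f ≫ deltaIter φ Δ p y = deltaIter φ Δ p x ≫ (funcPow φ p).map f := by
  induction p with
  | zero => simp [deltaIter, funcPow]
  | succ n ih =>
    have hn := Δ.naturality ((funcPow φ n).map f)
    simp only [Functor.id_map] at hn
    change f ≫ deltaIter φ Δ n y ≫ Δ.app ((funcPow φ n).obj y) =
      (deltaIter φ Δ n x ≫ Δ.app ((funcPow φ n).obj x)) ≫ φ.map ((funcPow φ n).map f)
    rw [← Category.assoc, ih, Category.assoc, Category.assoc]
    exact congrArg (deltaIter φ Δ n x ≫ ·) hn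

/-- A morphism `c : x ⟶ x` commutes with `Δ^p_x` if and only if it is fixed by `φ^p`
(after transport along `h : φ^p(x) = x`). -/
theorem centralizer_deltaPow_iff_fixed {G : Type*} [Groupoid G] (φ : G ⥤ G)
    (Δ : 𝟭 G ⟶ φ) (p : ℕ) (hp : 1 ≤ p) (x : G) (h : (funcPow φ p).obj x = x)
    (c : x ⟶ x) :
    c ≫ (deltaIter φ Δ p x ≫ eqToHom h) = (deltaIter φ Δ p x ≫ eqToHom h) ≫ c ↔
      (funcPow φ p).map c = eqToHom h ≫ c ≫ eqToHom h.symm := by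
  have hnat := deltaIter_naturality φ Δ p c
  rw [← Category.assoc, hnat, Category.assoc, Category.assoc,
    cancel_epi (deltaIter φ Δ p x), ← cancel_mono (eqToHom h)]
  simp
end
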